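/- Suppose there exists M ∈ ℝ such that (∂a/∂t)(θ,t) ≤ M·a(θ,t) for all (θ,t) ∈ ℝ × [0,T). Then along the generalized Minkowski curvature flow the 𝒬_t-length L(t) := ∫₀^{2π} v(u,t) du satisfies L(t) ≤ e^{Mt}·L(0) for all t ∈ [0,T); in particular L is bounded on [0,T) when T < ∞. -/

import Mathlib

open Real Set

noncomputable def wedge (x y : ℝ × ℝ) : ℝ := x.1 * y.2 - x.2 * y.1

noncomputable def er (θ : ℝ) : ℝ × ℝ := (Real.cos θ, Real.sin θ)

noncomputable def etheta (θ : ℝ) : ℝ × ℝ := (-Real.sin θ, Real.cos θ)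

/-- partial derivative in the first (spatial) variable -/
noncomputable def pd (f : ℝ → ℝ → ℝ) (θ t : ℝ) : ℝ := deriv (fun x => f x t) θ

/-- partial derivative in the second (time) variable -/
noncomputable def pt (f : ℝ → ℝ → ℝ) (θ t : ℝ) : ℝ := deriv (fun s => f θ s) t

/-- partial derivative in the first variable, vector valued -/
noncomputable def pdv (f : ℝ → ℝ → ℝ × ℝ) (θ t : ℝ) : ℝ × ℝ := deriv (fun x => f x t) θ

/-- partial derivative in the second variable, vector valued -/
noncomputable def ptv (f : ℝ → ℝ → ℝ × ℝ) (θ t : ℝ) : ℝ × ℝ := deriv (fun s => f θ s) t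

theorem hasDerivAt_fst_slice {E : Type*} [NormedAddCommGroup E] [NormedSpace ℝ E]
    {f : ℝ × ℝ → E} {x t : ℝ} (hf : DifferentiableAt ℝ f (x, t)) :
    HasDerivAt (fun y => f (y, t)) (fderiv ℝ f (x, t) (1, 0)) x :=
  hf.hasFDerivAt.comp_hasDerivAt x ((hasDerivAt_id x).prodMk (hasDerivAt_const x t))

theorem hasDerivAt_snd_slice {E : Type*} [NormedAddCommGroup E] [NormedSpace ℝ E]
    {f : ℝ × ℝ → E} {x t : ℝ} (hf : DifferentiableAt ℝ f (x, t)) :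
    HasDerivAt (fun s => f (x, s)) (fderiv ℝ f (x, t) (0, 1)) t :=
  hf.hasFDerivAt.comp_hasDerivAt t ((hasDerivAt_const t x).prodMk (hasDerivAt_id t))

theorem hasDerivAt_pd {f : ℝ → ℝ → ℝ} (hf : Differentiable ℝ (Function.uncurry f)) (x t : ℝ) :
    HasDerivAt (fun y => f y t) (pd f x t) x :=
  (hasDerivAt_fst_slice (hf (x, t))).differentiableAt.hasDerivAt

theorem hasDerivAt_pt {f : ℝ → ℝ → ℝ} (hf : Differentiable ℝ (Function.uncurry f)) (x t : ℝ) :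
    HasDerivAt (fun s => f x s) (pt f x t) t :=
  (hasDerivAt_snd_slice (hf (x, t))).differentiableAt.hasDerivAt

theorem contDiff_pd {f : ℝ → ℝ → ℝ} (hf : ContDiff ℝ (⊤ : ℕ∞) (Function.uncurry f)) :
    ContDiff ℝ (⊤ : ℕ∞) (Function.uncurry (pd f)) := by
  have h : Function.uncurry (pd f) = fun z => fderiv ℝ (Function.uncurry f) z (1, 0) := by
    ext ⟨x, t⟩
    exact (hasDerivAt_fst_slice (hf.differentiable (by simp) (x, t))).deriv
  rw [h]
  exact (hf.fderiv_right (m := (⊤ : ℕ∞)) (by simp)).clm_apply contDiff_const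

/-- Chain rule along the moving point `(g s, s)`. -/
theorem hasDerivAt_along_graph {f : ℝ → ℝ → ℝ} (hf : Differentiable ℝ (Function.uncurry f))
    {g : ℝ → ℝ} {g' t : ℝ} (hg : HasDerivAt g g' t) :
    HasDerivAt (fun s => f (g s) s) (pd f (g t) t * g' + pt f (g t) t) t := by
  have h : HasDerivAt (fun s => f (g s) s) (fderiv ℝ (Function.uncurry f) (g t, t) (g', 1)) t :=
    HasFDerivAt.comp_hasDerivAt (l := Function.uncurry f) (f := fun s => (g s, s)) t
      (hf (g t, t)).hasFDerivAt (hg.prodMk (hasDerivAt_id t))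
  have hx : pd f (g t) t = _ := (hasDerivAt_fst_slice (hf (g t, t))).deriv
  have ht : pt f (g t) t = _ := (hasDerivAt_snd_slice (hf (g t, t))).deriv
  refine h.congr_deriv ?_
  have e : ((g', 1) : ℝ × ℝ) = g' • (1, 0) + (0, 1) := by simp
  rw [e, map_add, map_smul, hx, ht, smul_eq_mul, mul_comm]

theorem hasDerivAt_comp_slice {f : ℝ → ℝ → ℝ} (hf : Differentiable ℝ (Function.uncurry f))
    {g : ℝ → ℝ} {g' x t : ℝ} (hg : HasDerivAt g g' x) :
    HasDerivAt (fun y => f (g y) t) (pd f (g x) t * g') x :=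
  HasDerivAt.comp x (h₂ := fun y => f y t) (hasDerivAt_pd hf (g x) t) hg

/-- Equality of mixed partial derivatives. -/
theorem exists_hasDerivAt_pdv_ptv {F : ℝ → ℝ → ℝ × ℝ}
    (hF : ContDiff ℝ (⊤ : ℕ∞) (Function.uncurry F)) (u t : ℝ) :
    ∃ m, HasDerivAt (fun s => pdv F u s) m t ∧ HasDerivAt (fun x => ptv F x t) m u := by
  have hd : Differentiable ℝ (Function.uncurry F) := hF.differentiable (by simp)
  have hd2 : Differentiable ℝ (fderiv ℝ (Function.uncurry F)) :=
    (hF.fderiv_right (m := (⊤ : ℕ∞)) (by simp)).differentiable (by simp)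
  have hx : (fun s => pdv F u s) = fun s => fderiv ℝ (Function.uncurry F) (u, s) (1, 0) :=
    funext fun s => (hasDerivAt_fst_slice (hd (u, s))).deriv
  have ht : (fun x => ptv F x t) = fun x => fderiv ℝ (Function.uncurry F) (x, t) (0, 1) :=
    funext fun x => (hasDerivAt_snd_slice (hd (x, t))).deriv
  have hsymm : IsSymmSndFDerivAt ℝ (Function.uncurry F) (u, t) :=
    hF.contDiffAt.isSymmSndFDerivAt (by
      simpa using WithTop.coe_le_coe.2 (le_top : (2 : ℕ∞) ≤ ⊤))
  refine ⟨fderiv ℝ (fderiv ℝ (Function.uncurry F)) (u, t) (0, 1) (1, 0), ?_, ?_⟩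
  · rw [hx]
    simpa using (hasDerivAt_snd_slice (hd2 (u, t))).clm_apply (hasDerivAt_const t ((1, 0) : ℝ × ℝ))
  · rw [ht, hsymm.eq]
    simpa using (hasDerivAt_fst_slice (hd2 (u, t))).clm_apply (hasDerivAt_const u ((0, 1) : ℝ × ℝ))

/-- Evolution of the `𝒬_t`-speed: `∂v/∂t = (a⁻¹ ∂a/∂t - k²) v`. -/
theorem pt_speed_eq {T : ℝ} {a : ℝ → ℝ → ℝ} (ha : ContDiff ℝ (⊤ : ℕ∞) (Function.uncurry a))
    (hapos : ∀ θ t, t ∈ Set.Ico 0 T → 0 < a θ t)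
    {p q : ℝ → ℝ → ℝ × ℝ}
    (hp : ∀ θ t, p θ t = a θ t • er θ + pd a θ t • etheta θ)
    (hq : ∀ θ t, q θ t = (a θ t)⁻¹ • etheta θ)
    {F : ℝ → ℝ → ℝ × ℝ} (hF : ContDiff ℝ (⊤ : ℕ∞) (Function.uncurry F))
    {Θ : ℝ → ℝ → ℝ} (hΘsm : ContDiff ℝ (⊤ : ℕ∞) (Function.uncurry Θ))
    {v : ℝ → ℝ → ℝ} (hvsm : ContDiff ℝ (⊤ : ℕ∞) (Function.uncurry v))
    (hvpos : ∀ u t, t ∈ Set.Ico 0 T → 0 < v u t)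
    {k : ℝ → ℝ → ℝ}
    (hk : ∀ u t, k u t =
      a (Θ u t) t * (a (Θ u t) t + pd (pd a) (Θ u t) t) * pd Θ u t / v u t)
    (hFu : ∀ u t, t ∈ Set.Ico 0 T → pdv F u t = v u t • q (Θ u t) t)
    (hFt : ∀ u t, t ∈ Set.Ico 0 T → ptv F u t = (-(k u t)) • p (Θ u t) t)
    {u t : ℝ} (ht : t ∈ Set.Ioo 0 T) :
    pt v u t = (pt a (Θ u t) t / a (Θ u t) t - k u t ^ 2) * v u t := by
  have htI : t ∈ Set.Ico 0 T := ⟨ht.1.le, ht.2⟩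
  have hnhds : ∀ᶠ s in nhds t, s ∈ Set.Ico 0 T := by
    filter_upwards [isOpen_Ioo.mem_nhds ht] with s hs using ⟨hs.1.le, hs.2⟩
  have hda := ha.differentiable (by simp)
  have hda1 := (contDiff_pd ha).differentiable (by simp)
  have hda2 := (contDiff_pd (contDiff_pd ha)).differentiable (by simp)
  have hdΘ := hΘsm.differentiable (by simp)
  have hdΘ1 := (contDiff_pd hΘsm).differentiable (by simp)
  have hdv := hvsm.differentiable (by simp)
  have hα := hapos (Θ u t) t htI
  have hv := hvpos u t htI
  obtain ⟨m, hmt, hmu⟩ := exists_hasDerivAt_pdv_ptv hF u t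
  have hmt1 : HasDerivAt (fun s => (pdv F u s).1) m.1 t := 
    (ContinuousLinearMap.fst ℝ ℝ ℝ).hasFDerivAt.comp_hasDerivAt t hmt
  have hmt2 : HasDerivAt (fun s => (pdv F u s).2) m.2 t := 
    (ContinuousLinearMap.snd ℝ ℝ ℝ).hasFDerivAt.comp_hasDerivAt t hmt
  have hmu1 : HasDerivAt (fun x => (ptv F x t).1) m.1 u := 
    (ContinuousLinearMap.fst ℝ ℝ ℝ).hasFDerivAt.comp_hasDerivAt u hmu
  have hmu2 : HasDerivAt (fun x => (ptv F x t).2) m.2 u := 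
    (ContinuousLinearMap.snd ℝ ℝ ℝ).hasFDerivAt.comp_hasDerivAt u hmu
  have hΘt := hasDerivAt_pt hdΘ u t
  have hΘx := hasDerivAt_pd hdΘ u t
  have hA := hasDerivAt_along_graph hda hΘt
  have hFu1 : ∀ s ∈ Set.Ico 0 T, (pdv F u s).1 = -(v u s / a (Θ u s) s * sin (Θ u s)) := by
    intro s hs
    rw [hFu u s hs, hq]
    simp [etheta]
    ring
  have hFu2 : ∀ s ∈ Set.Ico 0 T, (pdv F u s).2 = v u s / a (Θ u s) s * cos (Θ u s) := by
    intro s hs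
    rw [hFu u s hs, hq]
    simp [etheta]
    ring
  have normal_component : m.1 * cos (Θ u t) + m.2 * sin (Θ u t)
      + pt Θ u t * (v u t / a (Θ u t) t) = 0 := by
    have h := (hmt1.mul hΘt.cos).add (hmt2.mul hΘt.sin)
    have h0 : HasDerivAt (fun _ : ℝ => (0 : ℝ)) 0 t := hasDerivAt_const t 0
    have e := h.unique (h0.congr_of_eventuallyEq (by
      filter_upwards [hnhds] with s hs
      simp only [Pi.add_apply, Pi.mul_apply, hFu1 s hs, hFu2 s hs]
      ring))
    rw [hFu1 t htI, hFu2 t htI] at e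
    linear_combination e - pt Θ u t * (v u t / a (Θ u t) t) * sin_sq_add_cos_sq (Θ u t)
  have tangential_component : pt v u t =
      (pd a (Θ u t) t * pt Θ u t + pt a (Θ u t) t) * (v u t / a (Θ u t) t)
        + a (Θ u t) t * (m.2 * cos (Θ u t) - m.1 * sin (Θ u t)) := by
    have h := hA.mul ((hmt2.mul hΘt.cos).sub (hmt1.mul hΘt.sin))
    have e := (hasDerivAt_pt hdv u t).unique (h.congr_of_eventuallyEq (by
      filter_upwards [hnhds] with s hs
      have hα' := (hapos (Θ u s) s hs).ne'
      simp only [Pi.sub_apply, Pi.mul_apply, hFu1 s hs, hFu2 s hs]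
      field_simp
      linear_combination -v u s * sin_sq_add_cos_sq (Θ u s)))
    simp only [Pi.sub_apply, Pi.mul_apply] at e
    rw [hFu1 t htI, hFu2 t htI] at e
    linear_combination e + (pd a (Θ u t) t * pt Θ u t + pt a (Θ u t) t) * (v u t / a (Θ u t) t)
      * sin_sq_add_cos_sq (Θ u t)
  have hkd : DifferentiableAt ℝ (fun x => k x t) u := by
    have e : (fun x => k x t) = fun x =>
      a (Θ x t) t * (a (Θ x t) t + pd (pd a) (Θ x t) t) * pd Θ x t / v x t := funext (hk · t)
    rw [e]
    have h0 : DifferentiableAt ℝ (fun x => a (Θ x t) t) u :=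
      (hasDerivAt_comp_slice hda hΘx).differentiableAt
    have h2 : DifferentiableAt ℝ (fun x => pd (pd a) (Θ x t) t) u :=
      (hasDerivAt_comp_slice hda2 hΘx).differentiableAt
    exact ((h0.mul (h0.add h2)).mul (hasDerivAt_pd hdΘ1 u t).differentiableAt).div
      (hasDerivAt_pd hdv u t).differentiableAt hv.ne'
  have hkx := hkd.hasDerivAt
  have hax : HasDerivAt (fun x => a (Θ x t) t) _ u :=
    hasDerivAt_comp_slice hda hΘx
  have ha1x : HasDerivAt (fun x => pd a (Θ x t) t) _ u :=
    hasDerivAt_comp_slice hda1 hΘx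
  have hm1 := hmu1.unique
    ((hkx.neg.mul ((hax.mul hΘx.cos).sub (ha1x.mul hΘx.sin))).congr_of_eventuallyEq (.of_forall fun x => by
      simp only [hFt x t htI, hp, Pi.mul_apply, Pi.sub_apply, Pi.neg_apply, er, etheta,
        Prod.smul_fst, Prod.fst_add, smul_eq_mul]
      ring))
  have hm2 := hmu2.unique
    ((hkx.neg.mul ((hax.mul hΘx.sin).add (ha1x.mul hΘx.cos))).congr_of_eventuallyEq (.of_forall fun x => by
      simp only [hFt x t htI, hp, Pi.mul_apply, Pi.add_apply, Pi.neg_apply, er, etheta,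
        Prod.smul_snd, Prod.snd_add, smul_eq_mul]))
  simp only [Pi.mul_apply, Pi.sub_apply, Pi.add_apply, Pi.neg_apply] at hm1 hm2
  generalize deriv (fun x => k x t) u = k' at hm1 hm2
  have hm_er : m.1 * cos (Θ u t) + m.2 * sin (Θ u t) = -(k' * a (Θ u t) t) := by
    rw [hm1, hm2]
    linear_combination (-(k' * a (Θ u t) t)) * sin_sq_add_cos_sq (Θ u t)
  have hm_etheta : m.2 * cos (Θ u t) - m.1 * sin (Θ u t) = -(k' * pd a (Θ u t) t)
      - k u t * ((a (Θ u t) t + pd (pd a) (Θ u t) t) * pd Θ u t) := by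
    rw [hm1, hm2]
    linear_combination (-(k' * pd a (Θ u t) t)
      - k u t * ((a (Θ u t) t + pd (pd a) (Θ u t) t) * pd Θ u t)) * sin_sq_add_cos_sq (Θ u t)
  have hkv : k u t * v u t =
      a (Θ u t) t * (a (Θ u t) t + pd (pd a) (Θ u t) t) * pd Θ u t := by
    rw [hk u t, div_mul_cancel₀ _ hv.ne']
  rw [tangential_component, hm_etheta]
  rw [hm_er] at normal_component
  linear_combination pd a (Θ u t) t * normal_component + k u t * hkv

theorem stmt3
    (T : ℝ) (hT : 0 < T)
    (a : ℝ → ℝ → ℝ) (ha : ContDiff ℝ (⊤ : ℕ∞) (Function.uncurry a))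
    (haper : ∀ θ t, a (θ + π) t = a θ t)
    (hapos : ∀ θ t, t ∈ Set.Ico 0 T → 0 < a θ t)
    (haapos : ∀ θ t, t ∈ Set.Ico 0 T → 0 < a θ t + pd (pd a) θ t)
    (p q : ℝ → ℝ → ℝ × ℝ)
    (hp : ∀ θ t, p θ t = a θ t • er θ + pd a θ t • etheta θ)
    (hq : ∀ θ t, q θ t = (a θ t)⁻¹ • etheta θ)
    (F : ℝ → ℝ → ℝ × ℝ) (hF : ContDiff ℝ (⊤ : ℕ∞) (Function.uncurry F))
    (hFper : ∀ u t, F (u + 2 * π) t = F u t)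
    (Θ : ℝ → ℝ → ℝ) (hΘsm : ContDiff ℝ (⊤ : ℕ∞) (Function.uncurry Θ))
    (hΘper : ∀ u t, Θ (u + 2 * π) t = Θ u t + 2 * π)
    (hΘu : ∀ u t, t ∈ Set.Ico 0 T → 0 < pd Θ u t)
    (v : ℝ → ℝ → ℝ) (hvsm : ContDiff ℝ (⊤ : ℕ∞) (Function.uncurry v))
    (hvpos : ∀ u t, t ∈ Set.Ico 0 T → 0 < v u t)
    (k : ℝ → ℝ → ℝ)
    (hk : ∀ u t, k u t =
      a (Θ u t) t * (a (Θ u t) t + pd (pd a) (Θ u t) t) * pd Θ u t / v u t)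
    (hFu : ∀ u t, t ∈ Set.Ico 0 T → pdv F u t = v u t • q (Θ u t) t)
    (hFt : ∀ u t, t ∈ Set.Ico 0 T → ptv F u t = (-(k u t)) • p (Θ u t) t)
    (L : ℝ → ℝ)
    (hL : ∀ t, L t = ∫ u in (0:ℝ)..2 * π, v u t)
    (M : ℝ)
    (hM : ∀ θ t, t ∈ Set.Ico 0 T → pt a θ t ≤ M * a θ t) :
    (∀ t ∈ Set.Ico 0 T, L t ≤ Real.exp (M * t) * L 0) ∧
    ∃ C : ℝ, ∀ t ∈ Set.Ico 0 T, L t ≤ C := by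
  have hdv := hvsm.differentiable (by simp)
  have hbound : ∀ t ∈ Set.Ico 0 T, ∀ u, v u t ≤ Real.exp (M * t) * v u 0 := by
    intro t ht u
    have hE : ∀ s, HasDerivAt (fun s => Real.exp (-(M * s)) * v u s)
        (Real.exp (-(M * s)) * (pt v u s - M * v u s)) s := by
      intro s
      have h := (((hasDerivAt_id s).const_mul M).neg.exp).mul (hasDerivAt_pt hdv u s)
      refine h.congr_deriv ?_
      simp
      ring
    have hanti : AntitoneOn (fun s => Real.exp (-(M * s)) * v u s) (Set.Icc 0 t) := by
      refine antitoneOn_of_deriv_nonpos (convex_Icc 0 t)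
        (fun s _ => (hE s).continuousAt.continuousWithinAt)
        (fun s _ => (hE s).differentiableAt.differentiableWithinAt) fun s hs => ?_
      rw [interior_Icc] at hs
      have hsT : s < T := hs.2.trans ht.2
      have hsI : s ∈ Set.Ico 0 T := ⟨hs.1.le, hsT⟩
      rw [(hE s).deriv, pt_speed_eq ha hapos hp hq hF hΘsm hvsm hvpos hk hFu hFt ⟨hs.1, hsT⟩]
      have hquot : pt a (Θ u s) s / a (Θ u s) s ≤ M :=
        (div_le_iff₀ (hapos _ s hsI)).2 (hM _ s hsI)
      refine mul_nonpos_of_nonneg_of_nonpos (Real.exp_pos _).le ?_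
      nlinarith [hvpos u s hsI, sq_nonneg (k u s)]
    have h := hanti ⟨le_rfl, ht.1⟩ ⟨ht.1, le_rfl⟩ ht.1
    simp only [mul_zero, neg_zero, Real.exp_zero, one_mul, Real.exp_neg] at h
    exact (inv_mul_le_iff₀ (Real.exp_pos _)).1 h
  have hcont : ∀ t, Continuous fun u => v u t := fun t =>
    hvsm.continuous.comp (Continuous.prodMk_left t)
  have hlen : ∀ t ∈ Set.Ico 0 T, L t ≤ Real.exp (M * t) * L 0 := by
    intro t ht
    rw [hL, hL, ← intervalIntegral.integral_const_mul]
    exact intervalIntegral.integral_mono_on (by positivity)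
      ((hcont t).intervalIntegrable _ _)
      (((hcont 0).const_mul _).intervalIntegrable _ _) fun u _ => hbound t ht u
  have hL0 : 0 ≤ L 0 := by
    rw [hL]
    exact intervalIntegral.integral_nonneg (by positivity)
      fun u _ => (hvpos u 0 ⟨le_rfl, hT⟩).le
  refine ⟨hlen, Real.exp (|M| * T) * L 0, fun t ht => (hlen t ht).trans ?_⟩
  gcongr
  · exact ht.1
  · exact le_abs_self M
  · exact ht.2.le
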